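/- arXiv:2309.06570 — 3 statements merged into one kernel-verified Lean document; each statement's English description precedes it below -/
import Mathlib

section
/- Let n ≥ 1 and let s < 2^n be a natural number with binary digits s_0, s_1, …, s_{n−1}. Then Z_n(s) = Σ_{k=0}^{n−1} g_k 2^k, where g_{n−1} := s_0 and g_k := s_0 ⊕ s_1 ⊕ ⋯ ⊕ s_{n−1−k} for 0 ≤ k ≤ n−2 (⊕ denoting addition modulo 2). In other words, the number of sign changes of the Walsh basis vector in natural ordering ((−1)^{s·k})_{k=0}^{2^n−1} equals g(s) := Σ_{k=0}^{n−1} g_k 2^k. -/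
/-- The `i`-th binary digit of `s`, as a natural number in `{0,1}`. -/
def bit (s i : ℕ) : ℕ := (s.testBit i).toNat

/-- Bitwise dot product of `s` and `x` modulo 2: `s·x = Σ_i s_i x_i mod 2`.
(All bits of `s` beyond position `s` vanish, so the range `s+1` covers all terms.) -/
def dot (s x : ℕ) : ℕ := (∑ i ∈ Finset.range (s + 1), bit s i * bit x i) % 2

/-- `Z_m(x) = (1/2) Σ_{k=0}^{2^m-2} |(-1)^{x·(k+1)} - (-1)^{x·k}|`, the number of sign
changes of the vector `((-1)^{x·k})_{k=0}^{2^m-1}`. -/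
noncomputable def Z (m x : ℕ) : ℝ :=
  (1/2) * ∑ k ∈ Finset.range (2^m - 1), |(-1:ℝ)^(dot x (k+1)) - (-1:ℝ)^(dot x k)|

/-- The bit `g_k := s_0 ⊕ s_1 ⊕ ⋯ ⊕ s_{n-1-k}` (parity of the `n-k` least significant
bits of `s`); in particular `g_{n-1} = s_0` and `g_n = 0`. -/
def gbit (n s k : ℕ) : ℕ := (∑ i ∈ Finset.range (n - k), bit s i) % 2

/-- `g(s) := Σ_{k=0}^{n-1} g_k 2^k`. -/
def gFun (n s : ℕ) : ℕ := ∑ k ∈ Finset.range n, gbit n s k * 2^k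

/-- `e_n(k,j) := Σ_{r=0}^{n-1} k_{n-1-r} (j_r ⊕ j_{r+1}) mod 2`. -/
def eSeq (n k j : ℕ) : ℕ :=
  (∑ r ∈ Finset.range n, bit k (n-1-r) * ((bit j r + bit j (r+1)) % 2)) % 2

/-- The sequency-ordered Walsh–Hadamard matrix `H^S_N`, `N = 2^n`, with
`(k,j)` entry `(1/√N)·(-1)^{e_n(k,j)}`. -/
noncomputable def HS (n : ℕ) : Matrix (Fin (2^n)) (Fin (2^n)) ℝ :=
  Matrix.of fun k j => (1 / Real.sqrt (2^n)) * (-1)^(eSeq n k j)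

/-- The natural-ordered Walsh–Hadamard matrix `H_N`, `N = 2^n`, with
`(k,j)` entry `(1/√N)·(-1)^{k·j}`. -/
noncomputable def Hnat (n : ℕ) : Matrix (Fin (2^n)) (Fin (2^n)) ℝ :=
  Matrix.of fun k j => (1 / Real.sqrt (2^n)) * (-1)^(dot k j)

theorem bit_eq_zero_of_le {s i : ℕ} (h : s ≤ i) : bit s i = 0 := by
  simp [bit, Nat.testBit_lt_two_pow (h.trans_lt Nat.lt_two_pow_self)]

theorem bit_add_two_pow {x m : ℕ} (hx : x < 2 ^ m) (i : ℕ) :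
    bit (x + 2 ^ m) i = bit x i + if i = m then 1 else 0 := by
  unfold bit
  rw [add_comm x]
  rcases lt_trichotomy i m with h | rfl | h
  · simp [Nat.testBit_two_pow_add_gt h, h.ne]
  · simp [Nat.testBit_two_pow_add_eq, Nat.testBit_lt_two_pow hx]
  · have h₁ : 2 ^ m + x < 2 ^ i :=
      calc 2 ^ m + x < 2 ^ (m + 1) := by rw [pow_succ]; omega
        _ ≤ 2 ^ i := Nat.pow_le_pow_right (by norm_num) h
    simp [Nat.testBit_lt_two_pow h₁, Nat.testBit_lt_two_pow (show x < 2 ^ i by omega), h.ne']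

theorem neg_one_pow_dot_zero (s : ℕ) : (-1 : ℝ) ^ dot s 0 = 1 := by
  simp [dot, bit]

theorem neg_one_pow_dot_add_two_pow (s : ℕ) {x m : ℕ} (hx : x < 2 ^ m) :
    (-1 : ℝ) ^ dot s (x + 2 ^ m) = (-1) ^ dot s x * (-1) ^ bit s m := by
  have h : ∑ i ∈ Finset.range (s + 1), bit s i * bit (x + 2 ^ m) i =
      ∑ i ∈ Finset.range (s + 1), bit s i * bit x i + bit s m := by
    simp only [bit_add_two_pow hx, mul_add, Finset.sum_add_distrib, mul_ite, mul_one, mul_zero,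
      Finset.sum_ite_eq', Finset.mem_range, add_right_inj, ite_eq_left_iff, not_lt]
    exact fun hm => (bit_eq_zero_of_le (by omega)).symm
  rw [dot, dot, h, ← neg_one_pow_eq_pow_mod_two, ← neg_one_pow_eq_pow_mod_two, pow_add]

theorem neg_one_pow_dot_two_pow_sub_one (s m : ℕ) :
    (-1 : ℝ) ^ dot s (2 ^ m - 1) = (-1) ^ ∑ i ∈ Finset.range m, bit s i := by
  induction m with
  | zero => simp [neg_one_pow_dot_zero]
  | succ m ih =>
    have hpos : 0 < 2 ^ m := by positivity
    rw [show 2 ^ (m + 1) - 1 = (2 ^ m - 1) + 2 ^ m by rw [pow_succ]; omega,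
      neg_one_pow_dot_add_two_pow s (by omega), ih, Finset.sum_range_succ, pow_add]

theorem abs_neg_one_pow_sub_neg_one_pow (a b : ℕ) :
    |(-1 : ℝ) ^ a - (-1) ^ b| = 2 * ((b + a) % 2 : ℕ) := by
  rcases Nat.even_or_odd a with ha | ha <;> rcases Nat.even_or_odd b with hb | hb
  · simp [ha.neg_one_pow, hb.neg_one_pow, Nat.even_iff.1 (hb.add ha)]
  · simp [ha.neg_one_pow, hb.neg_one_pow, Nat.odd_iff.1 (hb.add_even ha)]; norm_num
  · simp [ha.neg_one_pow, hb.neg_one_pow, Nat.odd_iff.1 (hb.add_odd ha)]; norm_num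
  · simp [ha.neg_one_pow, hb.neg_one_pow, Nat.even_iff.1 (hb.add_odd ha)]

/-- The second half of a Walsh vector is the first half up to a sign, so doubling the length
doubles the number of sign changes, up to the one at the midpoint. -/
theorem Z_succ (m s : ℕ) : Z (m + 1) s = 2 * Z m s + gbit (m + 1) s 0 := by
  have hpos : 0 < 2 ^ m := by positivity
  have hmid : |(-1 : ℝ) ^ dot s (2 ^ m - 1 + 1) - (-1) ^ dot s (2 ^ m - 1)| =
      2 * (gbit (m + 1) s 0 : ℝ) := by
    rw [show 2 ^ m - 1 + 1 = 0 + 2 ^ m by omega, neg_one_pow_dot_add_two_pow s hpos,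
      neg_one_pow_dot_zero, one_mul, neg_one_pow_dot_two_pow_sub_one,
      abs_neg_one_pow_sub_neg_one_pow, gbit, Nat.sub_zero, Finset.sum_range_succ]
  have hsecond : ∀ k ∈ Finset.range (2 ^ m - 1),
      |(-1 : ℝ) ^ dot s (2 ^ m - 1 + 1 + k + 1) - (-1) ^ dot s (2 ^ m - 1 + 1 + k)| =
        |(-1 : ℝ) ^ dot s (k + 1) - (-1) ^ dot s k| := by
    intro k hk
    rw [Finset.mem_range] at hk
    rw [show 2 ^ m - 1 + 1 + k + 1 = k + 1 + 2 ^ m by omega,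
      show 2 ^ m - 1 + 1 + k = k + 2 ^ m by omega,
      neg_one_pow_dot_add_two_pow s (by omega), neg_one_pow_dot_add_two_pow s (by omega),
      ← sub_mul, abs_mul, abs_neg_one_pow, mul_one]
  rw [Z, Z, show 2 ^ (m + 1) - 1 = (2 ^ m - 1 + 1) + (2 ^ m - 1) by rw [pow_succ]; omega,
    Finset.sum_range_add, Finset.sum_range_succ, hmid, Finset.sum_congr rfl hsecond]
  ring

theorem gFun_succ (m s : ℕ) : gFun (m + 1) s = 2 * gFun m s + gbit (m + 1) s 0 := by
  rw [gFun, gFun, Finset.sum_range_succ', Finset.mul_sum, pow_zero, mul_one]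
  congr 1
  refine Finset.sum_congr rfl fun k _ => ?_
  rw [gbit, gbit, Nat.add_sub_add_right]
  ring

theorem Z_eq_gFun (m s : ℕ) : Z m s = gFun m s := by
  induction m with
  | zero => simp [Z, gFun]
  | succ m ih => rw [Z_succ, gFun_succ, ih]; push_cast; rfl

/-- Corollary: for `n ≥ 1` and `s < 2^n`,
`Z_n(s) = Σ_{k=0}^{n-1} g_k 2^k` where `g_{n-1} = s_0` and
`g_k = s_0 ⊕ ⋯ ⊕ s_{n-1-k}` for `k ≤ n-2`. -/
theorem stmt_1 (n : ℕ) (hn : 1 ≤ n) (s : ℕ) (hs : s < 2^n) :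
    Z n s = ((∑ k ∈ Finset.range n, gbit n s k * 2^k : ℕ) : ℝ) :=
  Z_eq_gFun n s
end

section
/- Let n ≥ 1 and N = 2^n. For all natural numbers s, j < N, e_n(g(s), j) ≡ s·j (mod 2); equivalently, the (g(s), j)-entry of the sequency-ordered Walsh–Hadamard matrix H^S_N equals the (s, j)-entry of the natural-ordered Walsh–Hadamard matrix H_N, so that H^S_N is obtained from H_N by permuting rows via the bijection s ↦ g(s). -/
/-- `g(s) < 2^n`, so `g(s)` is a valid row index. -/
theorem gFun_lt (n s : ℕ) : gFun n s < 2^n := by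
  calc gFun n s ≤ ∑ k ∈ Finset.range n, 1 * 2^k :=
        Finset.sum_le_sum fun k _ =>
          Nat.mul_le_mul_right _ (Nat.le_of_lt_succ (Nat.mod_lt _ (by norm_num)))
    _ < 2^n := by
        simpa using Nat.geomSum_lt le_rfl fun k hk => Finset.mem_range.mp hk

theorem bit_sum_mul_two_pow (n : ℕ) (b : ℕ → ℕ) (hb : ∀ i, b i < 2) {k : ℕ} (hk : k < n) :
    bit (∑ i ∈ Finset.range n, b i * 2 ^ i) k = b k := by
  induction n generalizing b k with
  | zero => omega
  | succ n ih =>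
    have hsum : ∑ i ∈ Finset.range (n + 1), b i * 2 ^ i
        = 2 * ∑ i ∈ Finset.range n, b (i + 1) * 2 ^ i + b 0 := by
      rw [Finset.sum_range_succ', Finset.mul_sum, pow_zero, mul_one]
      congr 1
      exact Finset.sum_congr rfl fun i _ => by ring
    have h0 := hb 0
    rw [hsum]
    cases k with
    | zero =>
      rw [bit, Nat.toNat_testBit]
      omega
    | succ k =>
      rw [bit, Nat.testBit_succ, Nat.mul_add_div two_pos, Nat.div_eq_of_lt h0, add_zero]
      exact ih (fun i => b (i + 1)) (fun i => hb (i + 1)) (by omega)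

theorem bit_gFun {n k : ℕ} (s : ℕ) (hk : k < n) : bit (gFun n s) k = gbit n s k :=
  bit_sum_mul_two_pow n (gbit n s) (fun _ => Nat.mod_lt _ two_pos) hk

theorem bit_eq_zero_of_lt_two_pow {s i n : ℕ} (hs : s < 2 ^ n) (hi : n ≤ i) : bit s i = 0 := by
  rw [bit, Nat.testBit_lt_two_pow (hs.trans_le (Nat.pow_le_pow_right two_pos hi))]
  rfl

/-- The digit range in `dot` may be replaced by any range containing all digits of `s`. -/
theorem dot_eq_sum_range {n s : ℕ} (hs : s < 2 ^ n) (x : ℕ) :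
    dot s x = (∑ i ∈ Finset.range n, bit s i * bit x i) % 2 := by
  have hvanish {m : ℕ} (hm : s < 2 ^ m) (i : ℕ) (hi : m ≤ i) : bit s i * bit x i = 0 := by
    rw [bit_eq_zero_of_lt_two_pow hm hi, zero_mul]
  have hself : s < 2 ^ (s + 1) := s.lt_succ_self.trans Nat.lt_two_pow_self
  rw [dot, ← Finset.eventually_constant_sum (hvanish hself) (le_max_left (s + 1) n),
    Finset.eventually_constant_sum (hvanish hs) (le_max_right (s + 1) n)]

/-- Summation by parts in characteristic two. -/
theorem sum_partialSum_mul_add_succ {R : Type*} [CommRing R] [CharP R 2] (a b : ℕ → R) (n : ℕ) :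
    ∑ r ∈ Finset.range n, (∑ i ∈ Finset.range (r + 1), a i) * (b r + b (r + 1))
      = ∑ r ∈ Finset.range n, a r * b r + (∑ i ∈ Finset.range n, a i) * b n := by
  induction n with
  | zero => simp
  | succ n ih =>
    rw [Finset.sum_range_succ, ih, Finset.sum_range_succ a,
      Finset.sum_range_succ (fun r => a r * b r)]
    linear_combination CharTwo.add_self_eq_zero ((∑ i ∈ Finset.range n, a i) * b n)

theorem eSeq_gFun {n s j : ℕ} (hs : s < 2 ^ n) (hj : j < 2 ^ n) :
    eSeq n (gFun n s) j = dot s j := by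
  rw [dot_eq_sum_range hs, eSeq]
  change _ ≡ _ [MOD 2]
  rw [← ZMod.natCast_eq_natCast_iff]
  have hparts := sum_partialSum_mul_add_succ
    (fun i => (bit s i : ZMod 2)) (fun i => (bit j i : ZMod 2)) n
  simp only [bit_eq_zero_of_lt_two_pow hj le_rfl, Nat.cast_zero, mul_zero, add_zero] at hparts
  push_cast
  rw [← hparts]
  refine Finset.sum_congr rfl fun r hr => ?_
  have hrn : r < n := Finset.mem_range.mp hr
  rw [bit_gFun s (by omega), gbit, show n - (n - 1 - r) = r + 1 by omega]
  simp only [ZMod.natCast_mod, Nat.cast_sum, Nat.cast_add]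


/-- for `n ≥ 1`, `N = 2^n` and `s, j < N`, `e_n(g(s), j) ≡ s·j (mod 2)`;
equivalently, the `(g(s), j)`-entry of the sequency-ordered Walsh–Hadamard matrix
`H^S_N` equals the `(s, j)`-entry of the natural-ordered Walsh–Hadamard matrix `H_N`,
so `H^S_N` is obtained from `H_N` by permuting rows via the bijection `s ↦ g(s)`. -/
theorem stmt_9 (n : ℕ) (hn : 1 ≤ n) (s j : Fin (2^n)) :
    eSeq n (gFun n s) j ≡ dot s j [MOD 2] ∧
    HS n ⟨gFun n s, gFun_lt n s⟩ j = Hnat n s j := by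
  have he : eSeq n (gFun n s) j = dot s j := eSeq_gFun s.isLt j.isLt
  refine ⟨congrArg (· % 2) he, ?_⟩
  simp only [HS, Hnat, Matrix.of_apply, he]
end

section
/- Let n ≥ 1. For all natural numbers a, b < 2^n, e_n(a, b) = e_n(b, a); consequently, the sequency-ordered Walsh–Hadamard matrix H^S_N (N = 2^n) is a symmetric matrix. -/
theorem bit_eq_zero_of_lt {s n : ℕ} (h : s < 2 ^ n) : bit s n = 0 := by
  simp [bit, Nat.testBit_lt_two_pow h]

/-- Separating the two summands of each `j_r ⊕ j_{r+1}` and dropping the vanishing top digit. -/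
theorem eSeq_succ_eq (m k j : ℕ) (hj : j < 2 ^ (m + 1)) :
    eSeq (m + 1) k j =
      (∑ r ∈ Finset.range (m + 1), bit k (m - r) * bit j r +
        ∑ r ∈ Finset.range m, bit k (m - r) * bit j (r + 1)) % 2 := by
  have h : ∑ r ∈ Finset.range m, bit k (m - r) * bit j (r + 1) =
      ∑ r ∈ Finset.range (m + 1), bit k (m - r) * bit j (r + 1) := by
    rw [Finset.sum_range_succ, bit_eq_zero_of_lt hj, mul_zero, add_zero]
  rw [h, ← Finset.sum_add_distrib, eSeq, Finset.sum_nat_mod]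
  conv_rhs => rw [Finset.sum_nat_mod]
  simp [← mul_add, Nat.mul_mod]

theorem eSeq_comm {n a b : ℕ} (ha : a < 2 ^ n) (hb : b < 2 ^ n) :
    eSeq n a b = eSeq n b a := by
  cases n with
  | zero => simp [eSeq]
  | succ m =>
    rw [eSeq_succ_eq m a b hb, eSeq_succ_eq m b a ha]
    congr 2
    · rw [← Finset.sum_range_reflect]
      refine Finset.sum_congr rfl fun r hr => ?_
      have hr' := Finset.mem_range.mp hr
      rw [mul_comm, show m + 1 - 1 - r = m - r by omega, show m - (m - r) = r by omega]
    · rw [← Finset.sum_range_reflect]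
      refine Finset.sum_congr rfl fun r hr => ?_
      have hr' := Finset.mem_range.mp hr
      rw [mul_comm, show m - 1 - r + 1 = m - r by omega,
        show m - (m - 1 - r) = r + 1 by omega]

/-- for `n ≥ 1` and `a, b < 2^n`, `e_n(a,b) = e_n(b,a)`; consequently
the sequency-ordered Walsh–Hadamard matrix `H^S_N` (`N = 2^n`) is symmetric. -/
theorem stmt_10 (n : ℕ) (hn : 1 ≤ n) (a b : ℕ) (ha : a < 2^n) (hb : b < 2^n) :
    eSeq n a b = eSeq n b a ∧ (HS n).IsSymm := by
  refine ⟨eSeq_comm ha hb, Matrix.IsSymm.ext fun i j => ?_⟩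
  simp only [HS, Matrix.of_apply, eSeq_comm i.isLt j.isLt]
end
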